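/- Let N be a natural number, A = ℤ[ℤ^N] the group ring AddMonoidAlgebra ℤ (Fin N → ℤ), M = Fin N → A the free A-module of rank N with standard basis (eᵢ), and λ : M → A the A-linear functional with λ(eᵢ) = xᵢ − 1, where xᵢ ∈ A are the group-like elements corresponding to the standard basis of ℤ^N. Let δ be left contraction by λ on the exterior algebra ⋀ M. Then the kernel of δ equals the sum of the range of δ and the A-submodule of ⋀ M spanned by 1. -/

import Mathlib

open scoped TensorProduct

namespace KoszulContraction

set_option linter.unusedSectionVars false

section CoordinateOperators

variable (k : Type*) [CommRing k] {σ : Type*} [DecidableEq σ]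

/-- The generator of the exterior algebra attached to a standard basis vector. -/
noncomputable def gen (i : σ) : ExteriorAlgebra k (σ → k) :=
  ExteriorAlgebra.ι k (Pi.single i 1)

/-- Contraction by a coordinate functional. -/
noncomputable def coordContract (i : σ) :
    ExteriorAlgebra k (σ → k) →ₗ[k] ExteriorAlgebra k (σ → k) :=
  CliffordAlgebra.contractLeft (LinearMap.proj i)

lemma gen_mul_self (i : σ) : gen k i * gen k i = 0 :=
  ExteriorAlgebra.ι_sq_zero _

lemma gen_mul_gen_add (i j : σ) : gen k i * gen k j + gen k j * gen k i = 0 :=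
  ExteriorAlgebra.ι_add_mul_swap _ _

lemma coordContract_one (i : σ) : coordContract k i 1 = 0 :=
  CliffordAlgebra.contractLeft_one _ _

lemma coordContract_gen_mul_self (i : σ) (u : ExteriorAlgebra k (σ → k)) :
    coordContract k i (gen k i * u) = u - gen k i * coordContract k i u := by
  refine (CliffordAlgebra.contractLeft_ι_mul (Q := (0 : QuadraticForm k (σ → k)))
    (LinearMap.proj i) (Pi.single i 1) u).trans ?_
  rw [LinearMap.proj_apply, Pi.single_eq_same, one_smul]
  rfl

lemma coordContract_gen_mul_of_ne {i j : σ} (h : i ≠ j) (u : ExteriorAlgebra k (σ → k)) :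
    coordContract k i (gen k j * u) = -(gen k j * coordContract k i u) := by
  refine (CliffordAlgebra.contractLeft_ι_mul (Q := (0 : QuadraticForm k (σ → k)))
    (LinearMap.proj i) (Pi.single j 1) u).trans ?_
  rw [LinearMap.proj_apply, Pi.single_eq_of_ne h, zero_smul, zero_sub]
  rfl

/-- The projection of the exterior algebra killing the `i`-th generator. -/
noncomputable def killGen (i : σ) : Module.End k (ExteriorAlgebra k (σ → k)) :=
  coordContract k i ∘ₗ LinearMap.mulLeft k (gen k i)

lemma killGen_apply (i : σ) (u : ExteriorAlgebra k (σ → k)) :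
    killGen k i u = coordContract k i (gen k i * u) := rfl

lemma killGen_one (i : σ) : killGen k i 1 = 1 := by
  rw [killGen_apply, coordContract_gen_mul_self, coordContract_one, mul_zero, sub_zero]

lemma killGen_gen_mul_self (i : σ) (u : ExteriorAlgebra k (σ → k)) :
    killGen k i (gen k i * u) = 0 := by
  rw [killGen_apply, ← mul_assoc, gen_mul_self, zero_mul, map_zero]

lemma killGen_gen_mul_of_ne {i j : σ} (h : i ≠ j) (u : ExteriorAlgebra k (σ → k)) :
    killGen k i (gen k j * u) = gen k j * killGen k i u := by
  rw [killGen_apply, killGen_apply, ← mul_assoc, eq_neg_of_add_eq_zero_left (gen_mul_gen_add k i j),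
    neg_mul, mul_assoc, map_neg, coordContract_gen_mul_of_ne k h, neg_neg]

lemma prod_killGen_one (l : List σ) : (l.map (killGen k)).prod 1 = 1 := by
  induction l with
  | nil => simp
  | cons i l ih => simp [ih, killGen_one]

lemma prod_killGen_gen_mul_of_notMem {l : List σ} {j : σ} (h : j ∉ l)
    (u : ExteriorAlgebra k (σ → k)) :
    (l.map (killGen k)).prod (gen k j * u) = gen k j * (l.map (killGen k)).prod u := by
  induction l with
  | nil => simp
  | cons i l ih =>
    rw [List.mem_cons, not_or] at h
    simp [ih h.2, killGen_gen_mul_of_ne k (Ne.symm h.1)]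

lemma prod_killGen_gen_mul_of_mem {l : List σ} {j : σ} (h : j ∈ l)
    (u : ExteriorAlgebra k (σ → k)) : (l.map (killGen k)).prod (gen k j * u) = 0 := by
  induction l with
  | nil => simp at h
  | cons i l ih =>
    by_cases hj : j ∈ l
    · simp [ih hj]
    · obtain rfl : j = i := by simpa [hj] using h
      simp [prod_killGen_gen_mul_of_notMem k hj, killGen_gen_mul_self]

lemma ι_eq_sum_gen [Fintype σ] (m : σ → k) : ExteriorAlgebra.ι k m = ∑ i, m i • gen k i := by
  conv_lhs => rw [pi_eq_sum_univ' m]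
  simp only [map_sum, map_smul, gen]

/-- Killing all generators leaves only scalars. -/
lemma prod_killGen_mem_span_one [Fintype σ] (u : ExteriorAlgebra k (σ → k)) :
    ((Finset.univ : Finset σ).toList.map (killGen k)).prod u ∈
      Submodule.span k {(1 : ExteriorAlgebra k (σ → k))} := by
  induction u using CliffordAlgebra.left_induction with
  | algebraMap r =>
    rw [Algebra.algebraMap_eq_smul_one, map_smul, prod_killGen_one]
    exact Submodule.smul_mem _ _ (Submodule.mem_span_singleton_self _)
  | add x y hx hy => rw [map_add]; exact add_mem hx hy
  | ι_mul x m _ =>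
    have : (CliffordAlgebra.ι (0 : QuadraticForm k (σ → k))) m = ∑ i, m i • gen k i :=
      ι_eq_sum_gen k m
    simp [this, Finset.sum_mul, prod_killGen_gen_mul_of_mem]

end CoordinateOperators

section BaseChange

variable (k : Type*) [CommRing k] {σ : Type*} [DecidableEq σ] [Fintype σ]
  (R : Type*) [CommRing R] [Algebra k R]

/-- The degree one part of the comparison map to the base change of the exterior algebra over
`k`. -/
noncomputable def toBaseChangeAux : (σ → R) →ₗ[R] R ⊗[k] ExteriorAlgebra k (σ → k) :=
  Fintype.linearCombination R fun i => 1 ⊗ₜ gen k i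

lemma toBaseChangeAux_apply (m : σ → R) :
    toBaseChangeAux k R m = ∑ i, m i ⊗ₜ[k] gen k i := by
  simp [toBaseChangeAux, Fintype.linearCombination_apply, TensorProduct.smul_tmul']

lemma toBaseChangeAux_sq (m : σ → R) :
    toBaseChangeAux k R m * toBaseChangeAux k R m = 0 := by
  rw [toBaseChangeAux_apply, Finset.sum_mul_sum, ← Finset.sum_product']
  refine Finset.sum_involution (fun p _ => p.swap) ?_ ?_ (by simp) (by simp)
  · rintro ⟨i, j⟩ _
    simp [mul_comm (m j), ← TensorProduct.tmul_add, gen_mul_gen_add]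
  · rintro ⟨i, j⟩ _ h hij
    obtain rfl : j = i := congrArg Prod.fst hij
    simp [gen_mul_self] at h

/-- The comparison map from the exterior algebra over `R` to the base change of the one over
`k`. -/
noncomputable def toBaseChange :
    ExteriorAlgebra R (σ → R) →ₐ[R] R ⊗[k] ExteriorAlgebra k (σ → k) :=
  ExteriorAlgebra.lift R ⟨toBaseChangeAux k R, toBaseChangeAux_sq k R⟩

lemma toBaseChange_ι (m : σ → R) :
    toBaseChange k R (ExteriorAlgebra.ι R m) = ∑ i, m i ⊗ₜ[k] gen k i := by
  rw [toBaseChange, ExteriorAlgebra.lift_ι_apply, toBaseChangeAux_apply]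

/-- The comparison map between the exterior algebras over `k` and over `R`. -/
noncomputable def scalarExtension : ExteriorAlgebra k (σ → k) →ₐ[k] ExteriorAlgebra R (σ → R) :=
  ExteriorAlgebra.lift k
    ⟨(ExteriorAlgebra.ι R).restrictScalars k ∘ₗ (Algebra.linearMap k R).compLeft σ,
      fun m => ExteriorAlgebra.ι_sq_zero ((Algebra.linearMap k R).compLeft σ m)⟩

lemma scalarExtension_gen (i : σ) : scalarExtension k R (gen k i) = gen R i := by
  have hi : (Algebra.linearMap k R).compLeft σ (Pi.single i 1) = Pi.single i 1 := by
    ext j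
    by_cases h : j = i <;> simp [h]
  refine (ExteriorAlgebra.lift_ι_apply _ _ _ _).trans ?_
  rw [LinearMap.comp_apply, hi]
  rfl

/-- The comparison map from the base change of the exterior algebra over `k` to the exterior
algebra over `R`. -/
noncomputable def ofBaseChange :
    R ⊗[k] ExteriorAlgebra k (σ → k) →ₐ[R] ExteriorAlgebra R (σ → R) :=
  Algebra.TensorProduct.lift (Algebra.ofId _ _)
    (scalarExtension k R) fun r _ => Algebra.commute_algebraMap_left r _

lemma ofBaseChange_tmul_gen (r : R) (i : σ) :
    ofBaseChange k R (r ⊗ₜ gen k i) = r • gen R i := by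
  refine (Algebra.TensorProduct.lift_tmul _ _ _ _ _).trans ?_
  rw [scalarExtension_gen, Algebra.ofId_apply, Algebra.smul_def]

/-- The exterior algebra of a finite free module commutes with base change. -/
noncomputable def baseChangeEquiv :
    ExteriorAlgebra R (σ → R) ≃ₐ[R] R ⊗[k] ExteriorAlgebra k (σ → k) :=
  AlgEquiv.ofAlgHom (toBaseChange k R) (ofBaseChange k R)
    (by
      refine Algebra.TensorProduct.ext (by ext) (ExteriorAlgebra.hom_ext ?_)
      refine LinearMap.pi_ext' fun i => LinearMap.ext_ring ?_
      change toBaseChange k R (ofBaseChange k R (1 ⊗ₜ gen k i)) = 1 ⊗ₜ gen k i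
      rw [ofBaseChange_tmul_gen, one_smul, gen, toBaseChange_ι,
        Finset.sum_eq_single i (fun j _ h => by simp [h]) (by simp)]
      simp)
    (by
      refine ExteriorAlgebra.hom_ext (LinearMap.ext fun m => ?_)
      change ofBaseChange k R (toBaseChange k R (ExteriorAlgebra.ι R m)) = ExteriorAlgebra.ι R m
      rw [toBaseChange_ι, map_sum, ι_eq_sum_gen]
      simp only [ofBaseChange_tmul_gen])

lemma baseChangeEquiv_ι (m : σ → R) :
    baseChangeEquiv k R (ExteriorAlgebra.ι R m) = ∑ i, m i ⊗ₜ[k] gen k i :=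
  toBaseChange_ι k R m

variable {R}

/-- The Koszul differential on the base change of the exterior algebra over `k`. -/
noncomputable def koszulDiff (a : σ → R) :
    Module.End k (R ⊗[k] ExteriorAlgebra k (σ → k)) :=
  ∑ i, TensorProduct.map (LinearMap.mulLeft k (a i)) (coordContract k i)

lemma koszulDiff_tmul (a : σ → R) (r : R) (u : ExteriorAlgebra k (σ → k)) :
    koszulDiff k a (r ⊗ₜ u) = ∑ i, (a i * r) ⊗ₜ coordContract k i u := by
  simp [koszulDiff]

lemma koszulDiff_tmul_gen_mul (a : σ → R) (s : R) (i : σ)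
    (z : R ⊗[k] ExteriorAlgebra k (σ → k)) :
    koszulDiff k a (s ⊗ₜ gen k i * z) = (s * a i) • z - s ⊗ₜ gen k i * koszulDiff k a z := by
  induction z with
  | zero => simp
  | add x y hx hy => simp only [mul_add, map_add, hx, hy, smul_add]; abel
  | tmul r u =>
    rw [Algebra.TensorProduct.tmul_mul_tmul, koszulDiff_tmul, koszulDiff_tmul, eq_sub_iff_add_eq,
      Finset.mul_sum, ← Finset.sum_add_distrib, Finset.sum_eq_single i]
    · rw [coordContract_gen_mul_self, Algebra.TensorProduct.tmul_mul_tmul, mul_left_comm s,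
        ← TensorProduct.tmul_add, sub_add_cancel, TensorProduct.smul_tmul', smul_eq_mul]
      congr 1
      ring
    · intro j _ hj
      rw [coordContract_gen_mul_of_ne k hj, Algebra.TensorProduct.tmul_mul_tmul, mul_left_comm s,
        ← TensorProduct.tmul_add, neg_add_cancel, TensorProduct.tmul_zero]
    · simp

lemma baseChangeEquiv_contractLeft (lam : Module.Dual R (σ → R)) (w : ExteriorAlgebra R (σ → R)) :
    baseChangeEquiv k R (CliffordAlgebra.contractLeft (Q := (0 : QuadraticForm R (σ → R))) lam w) =
      koszulDiff k (fun i => lam (Pi.single i 1)) (baseChangeEquiv k R w) := by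
  induction w using CliffordAlgebra.left_induction with
  | algebraMap r =>
    rw [CliffordAlgebra.contractLeft_algebraMap, map_zero, AlgEquiv.commutes,
      Algebra.TensorProduct.algebraMap_apply, koszulDiff_tmul]
    simp [coordContract_one]
  | add x y hx hy => simp only [map_add, hx, hy]
  | ι_mul x m hx =>
    have hι : baseChangeEquiv k R (CliffordAlgebra.ι (0 : QuadraticForm R (σ → R)) m) =
        ∑ i, m i ⊗ₜ[k] gen k i := baseChangeEquiv_ι k R m
    have hlam : lam m = ∑ i, m i * lam (Pi.single i 1) := by
      conv_lhs => rw [← Finset.univ_sum_single m]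
      rw [map_sum]
      refine Finset.sum_congr rfl fun i _ => ?_
      rw [← smul_eq_mul, ← map_smul, ← Pi.single_smul, smul_eq_mul, mul_one]
    rw [CliffordAlgebra.contractLeft_ι_mul, map_sub, map_smul, map_mul, map_mul, hx, hι,
      Finset.sum_mul, Finset.sum_mul, map_sum, hlam, Finset.sum_smul, ← Finset.sum_sub_distrib]
    simp only [koszulDiff_tmul_gen_mul]

lemma koszulDiff_koszulDiff (a : σ → R) (z : R ⊗[k] ExteriorAlgebra k (σ → k)) :
    koszulDiff k a (koszulDiff k a z) = 0 := by
  obtain ⟨w, rfl⟩ := (baseChangeEquiv k R).surjective z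
  have ha : a = fun i => Fintype.linearCombination R a (Pi.single i 1) := by
    ext i
    simp [Fintype.linearCombination_apply_single]
  rw [ha, ← baseChangeEquiv_contractLeft, ← baseChangeEquiv_contractLeft,
    CliffordAlgebra.contractLeft_contractLeft, map_zero]

end BaseChange

section Homotopy

variable {k : Type*} [CommRing k] {σ : Type*} [DecidableEq σ] [Fintype σ]
  {R : Type*} [CommRing R] [Algebra k R] {a : σ → R} {h : σ → R →ₗ[k] R}

/-- The endomorphism of the Koszul complex homotopic to the identity through `h i` followed by
multiplication by the `i`-th generator. -/
noncomputable def homotopyProj (a : σ → R) (h : σ → R →ₗ[k] R) (i : σ) :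
    Module.End k (R ⊗[k] ExteriorAlgebra k (σ → k)) :=
  TensorProduct.map (1 - LinearMap.mulLeft k (a i) * h i) (killGen k i)

lemma koszulDiff_homotopy (h_self : ∀ i r, h i (a i * r) = r)
    (h_ne : ∀ i j, j ≠ i → ∀ r, h i (a j * r) = a j * h i r) (i : σ)
    (z : R ⊗[k] ExteriorAlgebra k (σ → k)) :
    koszulDiff k a (TensorProduct.map (h i) (LinearMap.mulLeft k (gen k i)) z) +
      TensorProduct.map (h i) (LinearMap.mulLeft k (gen k i)) (koszulDiff k a z) =
        z - homotopyProj a h i z := by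
  induction z with
  | zero => simp
  | add x y hx hy =>
    simp only [map_add]
    rw [add_add_add_comm, hx, hy]
    abel
  | tmul r u =>
    rw [TensorProduct.map_tmul, koszulDiff_tmul, koszulDiff_tmul, map_sum,
      ← Finset.sum_add_distrib, Finset.sum_eq_single i]
    · have hu : gen k i * coordContract k i u = u - coordContract k i (gen k i * u) := by
        rw [coordContract_gen_mul_self, sub_sub_cancel]
      simp only [TensorProduct.map_tmul, LinearMap.mulLeft_apply, h_self, hu, homotopyProj,
        LinearMap.sub_apply, Module.End.one_apply, Module.End.mul_apply, killGen_apply,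
        TensorProduct.tmul_sub, TensorProduct.sub_tmul]
      abel
    · intro j _ hj
      rw [TensorProduct.map_tmul, h_ne i j hj, LinearMap.mulLeft_apply, LinearMap.mulLeft_apply,
        coordContract_gen_mul_of_ne k hj, ← TensorProduct.tmul_add, neg_add_cancel,
        TensorProduct.tmul_zero]
    · simp

lemma prod_homotopyProj (l : List σ) : ∃ f : Module.End k R,
    (l.map (homotopyProj a h)).prod = TensorProduct.map f (l.map (killGen k)).prod := by
  induction l with
  | nil => exact ⟨1, by simp⟩
  | cons i l ih =>
    obtain ⟨f, hf⟩ := ih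
    refine ⟨(1 - LinearMap.mulLeft k (a i) * h i) * f, ?_⟩
    rw [List.map_cons, List.prod_cons, List.map_cons, List.prod_cons, hf, homotopyProj,
      ← TensorProduct.map_mul]

lemma prod_homotopyProj_mem (z : R ⊗[k] ExteriorAlgebra k (σ → k)) :
    ∃ r : R, ((Finset.univ : Finset σ).toList.map (homotopyProj a h)).prod z = r ⊗ₜ[k] 1 := by
  obtain ⟨f, hf⟩ := prod_homotopyProj (a := a) (h := h) (Finset.univ : Finset σ).toList
  rw [hf]
  induction z with
  | zero => exact ⟨0, by simp⟩
  | add x y hx hy =>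
    obtain ⟨r, hr⟩ := hx
    obtain ⟨s, hs⟩ := hy
    exact ⟨r + s, by rw [map_add, hr, hs, TensorProduct.add_tmul]⟩
  | tmul r u =>
    obtain ⟨c, hc⟩ := Submodule.mem_span_singleton.1 (prod_killGen_mem_span_one k u)
    exact ⟨c • f r, by rw [TensorProduct.map_tmul, ← hc, TensorProduct.smul_tmul]⟩

lemma prod_homotopyProj_sub_mem_range (h_self : ∀ i r, h i (a i * r) = r)
    (h_ne : ∀ i j, j ≠ i → ∀ r, h i (a j * r) = a j * h i r) (l : List σ)
    {z : R ⊗[k] ExteriorAlgebra k (σ → k)} (hz : koszulDiff k a z = 0) :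
    z - (l.map (homotopyProj a h)).prod z ∈ LinearMap.range (koszulDiff k a) := by
  induction l with
  | nil => simp
  | cons i l ih =>
    obtain ⟨y, hy⟩ := ih
    set p := (l.map (homotopyProj a h)).prod z with hp
    have hpz : koszulDiff k a p = 0 := by
      rw [← sub_sub_cancel z p, ← hy, map_sub, hz, koszulDiff_koszulDiff, sub_zero]
    have key := koszulDiff_homotopy h_self h_ne i p
    rw [hpz, map_zero, add_zero] at key
    refine ⟨y + TensorProduct.map (h i) (LinearMap.mulLeft k (gen k i)) p, ?_⟩
    rw [map_add, key, hy, List.map_cons, List.prod_cons, Module.End.mul_apply, ← hp]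
    abel

/-- If each multiplication by `a i = lam eᵢ` has a left inverse commuting with the multiplications
by the other `a j`, then contraction by `lam` is exact up to scalars. -/
theorem ker_contractLeft_eq (lam : Module.Dual R (σ → R))
    (h_self : ∀ i r, h i (lam (Pi.single i 1) * r) = r)
    (h_ne : ∀ i j, j ≠ i → ∀ r, h i (lam (Pi.single j 1) * r) = lam (Pi.single j 1) * h i r) :
    LinearMap.ker (CliffordAlgebra.contractLeft (Q := (0 : QuadraticForm R (σ → R))) lam) =
      LinearMap.range (CliffordAlgebra.contractLeft (Q := (0 : QuadraticForm R (σ → R))) lam) ⊔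
        Submodule.span R {(1 : ExteriorAlgebra R (σ → R))} := by
  apply le_antisymm
  · intro w hw
    have hz : koszulDiff k (fun i => lam (Pi.single i 1)) (baseChangeEquiv k R w) = 0 := by
      rw [← baseChangeEquiv_contractLeft, LinearMap.mem_ker.1 hw, map_zero]
    obtain ⟨y, hy⟩ :=
      prod_homotopyProj_sub_mem_range h_self h_ne (Finset.univ : Finset σ).toList hz
    obtain ⟨r, hr⟩ := prod_homotopyProj_mem (a := fun i => lam (Pi.single i 1)) (h := h)
      (baseChangeEquiv k R w)
    obtain ⟨v, rfl⟩ := (baseChangeEquiv k R).surjective y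
    rw [hr, ← baseChangeEquiv_contractLeft, eq_sub_iff_add_eq] at hy
    refine Submodule.mem_sup.2 ⟨_, ⟨v, rfl⟩, r • 1,
      Submodule.smul_mem _ _ (Submodule.mem_span_singleton_self _),
      (baseChangeEquiv k R).injective ?_⟩
    rw [map_add, ← hy, map_smul, map_one, Algebra.TensorProduct.one_def,
      TensorProduct.smul_tmul', smul_eq_mul, mul_one]
  · refine sup_le ?_ ?_
    · rintro _ ⟨v, rfl⟩
      exact CliffordAlgebra.contractLeft_contractLeft lam v
    · rw [Submodule.span_singleton_le_iff_mem]
      exact CliffordAlgebra.contractLeft_one _ lam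

end Homotopy

section GroupRing

variable {σ : Type*} [DecidableEq σ]

/-- The quotient `(xᵢ ^ n - 1) / (xᵢ - 1)` in the group ring. -/
noncomputable def geomQuot (i : σ) : ℤ → AddMonoidAlgebra ℤ (σ → ℤ)
  | Int.ofNat n => ∑ j ∈ Finset.range n, AddMonoidAlgebra.single (Pi.single i (j : ℤ)) 1
  | Int.negSucc n =>
    -∑ j ∈ Finset.range (n + 1), AddMonoidAlgebra.single (Pi.single i (Int.negSucc j)) 1

lemma geomQuot_add_one (i : σ) (n : ℤ) :
    geomQuot i (n + 1) = geomQuot i n + AddMonoidAlgebra.single (Pi.single i n) 1 := by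
  match n with
  | Int.ofNat n => exact Finset.sum_range_succ _ n
  | Int.negSucc 0 => simp [geomQuot]
  | Int.negSucc (n + 1) =>
    rw [show Int.negSucc (n + 1) + 1 = Int.negSucc n from rfl, geomQuot, geomQuot,
      Finset.sum_range_succ _ (n + 1)]
    abel

/-- Division by `xᵢ - 1` in the group ring, as a linear map over the group ring of the other
variables. -/
noncomputable def divSubOne (i : σ) :
    AddMonoidAlgebra ℤ (σ → ℤ) →ₗ[ℤ] AddMonoidAlgebra ℤ (σ → ℤ) :=
  Finsupp.linearCombination ℤ (fun g : σ → ℤ =>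
      AddMonoidAlgebra.single (Function.update g i 0) 1 * geomQuot i (g i)) ∘ₗ
    (AddMonoidAlgebra.coeffLinearEquiv ℤ).toLinearMap

lemma divSubOne_single (i : σ) (g : σ → ℤ) (c : ℤ) :
    divSubOne i (AddMonoidAlgebra.single g c) =
      c • (AddMonoidAlgebra.single (Function.update g i 0) 1 * geomQuot i (g i)) := by
  simp [divSubOne]

lemma divSubOne_mul_self (i : σ) (f : AddMonoidAlgebra ℤ (σ → ℤ)) :
    divSubOne i ((AddMonoidAlgebra.single (Pi.single i 1) 1 - 1) * f) = f := by
  induction f using AddMonoidAlgebra.induction_linear with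
  | zero => simp
  | add x y hx hy => rw [mul_add, map_add, hx, hy]
  | single g c =>
    have hg : Function.update (Pi.single i 1 + g) i 0 = Function.update g i 0 := by
      ext j
      by_cases hj : j = i <;> simp [hj]
    have hg' : Function.update g i 0 + Pi.single i (g i) = g := by
      ext j
      by_cases hj : j = i
      · subst hj; simp
      · simp [hj]
    rw [sub_mul, one_mul, AddMonoidAlgebra.single_mul_single, map_sub, divSubOne_single,
      divSubOne_single, hg, Pi.add_apply, Pi.single_eq_same, add_comm (1 : ℤ), geomQuot_add_one,
      one_mul, ← smul_sub, ← mul_sub, add_sub_cancel_left, AddMonoidAlgebra.single_mul_single, hg']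
    simp

lemma divSubOne_mul_of_ne {i j : σ} (h : j ≠ i) (f : AddMonoidAlgebra ℤ (σ → ℤ)) :
    divSubOne i ((AddMonoidAlgebra.single (Pi.single j 1) 1 - 1) * f) =
      (AddMonoidAlgebra.single (Pi.single j 1) 1 - 1) * divSubOne i f := by
  induction f using AddMonoidAlgebra.induction_linear with
  | zero => simp
  | add x y hx hy => rw [mul_add, map_add, hx, hy, map_add, mul_add]
  | single g c =>
    have hg : Function.update (Pi.single j 1 + g) i 0 = Pi.single j 1 + Function.update g i 0 := by
      ext l
      by_cases hl : l = i
      · subst hl; simp [h.symm]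
      · simp [hl]
    rw [sub_mul, one_mul, AddMonoidAlgebra.single_mul_single, map_sub, divSubOne_single,
      divSubOne_single, hg, Pi.add_apply, Pi.single_eq_of_ne h.symm, zero_add, one_mul, sub_mul,
      one_mul, mul_smul_comm, ← mul_assoc, AddMonoidAlgebra.single_mul_single, one_mul]

end GroupRing

end KoszulContraction

/-- Exactness of the Koszul complex of the sequence `xᵢ − 1` over the group ring
`A = ℤ[ℤ^N]`: for the left contraction `δ` by the linear functional `λ(eᵢ) = xᵢ − 1`
on the exterior algebra of the free module `Fin N → A`, the kernel of `δ` equals the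
sum of the range of `δ` and the span of `1`. -/
theorem group_ring_koszul_contraction_exact (N : ℕ)
    (x : Fin N → AddMonoidAlgebra ℤ (Fin N → ℤ))
    (hx : ∀ i : Fin N, x i = AddMonoidAlgebra.single (Pi.single i 1) 1)
    (lam : Module.Dual (AddMonoidAlgebra ℤ (Fin N → ℤ))
      (Fin N → AddMonoidAlgebra ℤ (Fin N → ℤ)))
    (hlam : ∀ i : Fin N, lam (Pi.single i 1) = x i - 1)
    (δ : ExteriorAlgebra (AddMonoidAlgebra ℤ (Fin N → ℤ))
        (Fin N → AddMonoidAlgebra ℤ (Fin N → ℤ))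
      →ₗ[AddMonoidAlgebra ℤ (Fin N → ℤ)]
        ExteriorAlgebra (AddMonoidAlgebra ℤ (Fin N → ℤ))
          (Fin N → AddMonoidAlgebra ℤ (Fin N → ℤ)))
    (hδ : δ = CliffordAlgebra.contractLeft
      (Q := (0 : QuadraticForm (AddMonoidAlgebra ℤ (Fin N → ℤ))
        (Fin N → AddMonoidAlgebra ℤ (Fin N → ℤ)))) lam) :
    LinearMap.ker δ = LinearMap.range δ ⊔
      Submodule.span (AddMonoidAlgebra ℤ (Fin N → ℤ))
        {(1 : ExteriorAlgebra (AddMonoidAlgebra ℤ (Fin N → ℤ))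
          (Fin N → AddMonoidAlgebra ℤ (Fin N → ℤ)))} := by
  subst hδ
  have hlam' : ∀ i, lam (Pi.single i 1) = AddMonoidAlgebra.single (Pi.single i 1) 1 - 1 :=
    fun i => by rw [hlam, hx]
  refine KoszulContraction.ker_contractLeft_eq (k := ℤ) (h := KoszulContraction.divSubOne) lam
    (fun i r => ?_) (fun i j hij r => ?_)
  · rw [hlam', KoszulContraction.divSubOne_mul_self]
  · rw [hlam', KoszulContraction.divSubOne_mul_of_ne hij]
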